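/- arXiv:2009.12963 — 2 statements merged into one kernel-verified Lean document; each statement's English description precedes it below -/
import Mathlib

section
/- Let S = {θ ∈ F* : θ^{q−1} ∉ {1,−1} and θ^{q+1} ∉ {1,−1}}. Then |S| = (q−1)(q−3), and for every θ ∈ S the eight elements θ, −θ, θ⁻¹, −θ⁻¹, θ^q, −θ^q, θ^{−q}, −θ^{−q} are pairwise distinct (so S is partitioned into 8-element subsets of this form). -/
/-- In a finite cyclic group, if `d` divides the order of the group then exactly `d` elements
satisfy `x ^ d = 1`. -/
theorem IsCyclic.ncard_pow_eq_one {G : Type*} [CommGroup G] [Finite G] [IsCyclic G] {d : ℕ}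
    (hd : d ∣ Nat.card G) : {x : G | x ^ d = 1}.ncard = d := by
  have h := IsCyclic.card_powMonoidHom_ker G d
  rw [Nat.gcd_eq_right hd] at h
  exact h

theorem Units.pow_two_mul_eq_one_iff {R : Type*} [CommRing R] [NoZeroDivisors R] (x : Rˣ) (n : ℕ) :
    x ^ (2 * n) = 1 ↔ x ^ n = 1 ∨ x ^ n = -1 := by
  rw [mul_comm, pow_mul, sq, Units.ext_iff, Units.val_mul, Units.val_one, mul_self_eq_one_iff]
  simp [Units.ext_iff]

/-- The elements `±a, ±a⁻¹, ±b, ±b⁻¹` are pairwise distinct as soon as none of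
`a²`, `b²`, `a / b`, `a * b` is `1` or `-1`. -/
theorem Units.nodup_neg_inv {R : Type*} [CommRing R] (hR : (1 : Rˣ) ≠ -1) {a b : Rˣ}
    (ha : a * a ≠ 1) (ha' : a * a ≠ -1) (hb : b * b ≠ 1) (hb' : b * b ≠ -1)
    (hab : a ≠ b) (hab' : a ≠ -b) (hm : a * b ≠ 1) (hm' : a * b ≠ -1) :
    [a, -a, a⁻¹, -a⁻¹, b, -b, b⁻¹, -b⁻¹].Nodup := by
  have hneg (x : Rˣ) : x ≠ -x := fun h ↦ hR (by simpa using congrArg (x⁻¹ * ·) h)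
  have hinv {x y : Rˣ} (h : x * y ≠ 1) : x ≠ y⁻¹ := fun e ↦ h (eq_inv_iff_mul_eq_one.mp e)
  have hinv' {x y : Rˣ} (h : x * y ≠ -1) : x ≠ -y⁻¹ := fun e ↦ h (by rw [e]; simp)
  have hcomm : b * a = a * b := mul_comm b a
  have hab_inv : a⁻¹ ≠ -b⁻¹ := fun e ↦ hab' (by simpa using congrArg (·⁻¹) e)
  have hba : b * a ≠ 1 := hcomm ▸ hm
  have hba' : b * a ≠ -1 := hcomm ▸ hm'
  simp only [List.nodup_cons, List.mem_cons, List.not_mem_nil, or_false, not_or,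
    neg_eq_iff_eq_neg, neg_neg, inv_inj, List.nodup_nil, not_false_eq_true, and_true]
  refine ⟨⟨hneg _, hinv ha, hinv' ha', hab, hab', hinv hm, hinv' hm'⟩,
    ⟨hinv' ha', hinv ha, hab', hab, hinv' hm', hinv hm⟩,
    ⟨hneg _, (hinv hba).symm, ?_, hab, hab_inv⟩, ⟨?_, (hinv hba).symm, hab_inv, hab⟩,
    ⟨hneg _, hinv hb, hinv' hb'⟩, ⟨hinv' hb', hinv hb⟩, hneg _⟩
  all_goals exact fun e ↦ hinv' hba' (by rw [e, neg_neg])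

/-- in `F = GF(q²)` (`q` an odd prime power), the set
`S = {θ ∈ F* : θ^(q-1) ∉ {1,-1} and θ^(q+1) ∉ {1,-1}}` has exactly `(q-1)(q-3)` elements,
and for every `θ ∈ S` the eight elements `±θ, ±θ⁻¹, ±θ^q, ±θ^(-q)` are pairwise
distinct. -/
theorem card_S_and_eight_distinct (q : ℕ) (hq : Odd q) (hq' : IsPrimePow q)
    (F : Type) [Field F] [Fintype F] (hF : Fintype.card F = q ^ 2)
    (S : Set Fˣ)
    (hS : S = {θ : Fˣ | θ ^ (q - 1) ≠ 1 ∧ θ ^ (q - 1) ≠ -1 ∧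
      θ ^ (q + 1) ≠ 1 ∧ θ ^ (q + 1) ≠ -1}) :
    S.ncard = (q - 1) * (q - 3) ∧
    ∀ θ ∈ S,
      ([θ, -θ, θ⁻¹, -θ⁻¹, θ ^ q, -(θ ^ q), (θ ^ q)⁻¹, -(θ ^ q)⁻¹] : List Fˣ).Nodup := by
  subst hS
  have hq_one := hq'.one_lt
  obtain ⟨k, rfl⟩ := hq
  obtain ⟨m, rfl⟩ : ∃ m, k = m + 1 := ⟨k - 1, by omega⟩
  have hsub : 2 * (m + 1) + 1 - 1 = 2 * (m + 1) := rfl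
  have hsub' : 2 * (m + 1) + 1 - 3 = 2 * m := by omega
  have hadd : 2 * (m + 1) + 1 + 1 = 2 * (m + 2) := by ring
  rw [hsub, hsub', hadd]
  have hcard : Nat.card Fˣ = 4 * ((m + 1) * (m + 2)) := by
    rw [Nat.card_units, Nat.card_eq_fintype_card, hF]
    refine Nat.sub_eq_of_eq_add ?_
    ring
  have hchar : ringChar F ≠ 2 := by
    intro h
    have := FiniteField.even_card_of_char_two h
    have hodd : Odd (Fintype.card F) := by rw [hF]; exact (odd_two_mul_add_one _).pow
    rw [Nat.odd_iff] at hodd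
    omega
  have hone : (1 : Fˣ) ≠ -1 := fun h ↦
    Ring.neg_one_ne_one_of_char_ne_two hchar (by simpa using congrArg Units.val h.symm)
  constructor
  · set A : Set Fˣ := {x | x ^ (2 * (2 * (m + 1))) = 1} with hA
    set B : Set Fˣ := {x | x ^ (2 * (2 * (m + 2))) = 1} with hB
    have hAcard : A.ncard = 2 * (2 * (m + 1)) :=
      IsCyclic.ncard_pow_eq_one ⟨m + 2, by rw [hcard]; ring⟩
    have hBcard : B.ncard = 2 * (2 * (m + 2)) :=
      IsCyclic.ncard_pow_eq_one ⟨m + 1, by rw [hcard]; ring⟩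
    have hinter : A ∩ B = {x : Fˣ | x ^ 4 = 1} := by
      ext x
      simp only [hA, hB, Set.mem_inter_iff, Set.mem_ofPred_eq]
      constructor
      · rintro ⟨h₁, h₂⟩
        have : 2 * (2 * (m + 2)) = 2 * (2 * (m + 1)) + 4 := by ring
        rwa [this, pow_add, h₁, one_mul] at h₂
      · intro h
        constructor <;> rw [← mul_assoc, pow_mul, show 2 * 2 = 4 from rfl, h, one_pow]
    have hinter_card : (A ∩ B).ncard = 4 := by
      rw [hinter]
      exact IsCyclic.ncard_pow_eq_one ⟨_, hcard⟩
    have hcompl : {θ : Fˣ | θ ^ (2 * (m + 1)) ≠ 1 ∧ θ ^ (2 * (m + 1)) ≠ -1 ∧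
        θ ^ (2 * (m + 2)) ≠ 1 ∧ θ ^ (2 * (m + 2)) ≠ -1} = (A ∪ B)ᶜ := by
      ext x
      simp only [hA, hB, Set.mem_compl_iff, Set.mem_union, Set.mem_ofPred_eq,
        Units.pow_two_mul_eq_one_iff x (2 * _)]
      tauto
    have hunion := Set.ncard_union_add_ncard_inter A B
    have htotal := Set.ncard_add_ncard_compl (A ∪ B)
    rw [hcompl]
    have hring : 4 * ((m + 1) * (m + 2)) = 2 * (m + 1) * (2 * m) + 8 * (m + 1) := by ring
    omega
  · rintro θ ⟨h₁, h₂, h₃, h₄⟩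
    have hsq : θ * θ ≠ 1 := fun h ↦ h₁ (by rw [pow_mul, sq, h, one_pow])
    have hsq' : θ * θ ≠ -1 := fun h ↦
      (neg_one_pow_eq_or Fˣ (m + 1)).elim (fun e ↦ h₁ (by rw [pow_mul, sq, h, e]))
        (fun e ↦ h₂ (by rw [pow_mul, sq, h, e]))
    have hfrob : (θ ^ (2 * (m + 1) + 1)) ^ (2 * (m + 1) + 1) = θ := by
      ext
      rw [← pow_mul, ← sq, ← hF, Units.val_pow_eq_pow_val, FiniteField.pow_card]
    have hsq_pow (c : Fˣ) (h : θ ^ (2 * (m + 1) + 1) * θ ^ (2 * (m + 1) + 1) = c) :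
        θ * θ = c ^ (2 * (m + 1) + 1) := by
      rw [← h, mul_pow, hfrob]
    refine Units.nodup_neg_inv hone hsq hsq'
      (fun h ↦ hsq (by rw [hsq_pow 1 h, one_pow]))
      (fun h ↦ hsq' (by rw [hsq_pow (-1) h, (odd_two_mul_add_one _).neg_one_pow]))
      (fun h ↦ h₁ ?_) (fun h ↦ h₂ ?_) (fun h ↦ h₃ ?_) (fun h ↦ h₄ ?_)
    · rw [pow_succ] at h
      exact right_eq_mul.mp h
    · rw [pow_succ, ← neg_mul] at h
      rw [← right_eq_mul.mp h, neg_neg]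
    · rwa [← hadd, pow_succ']
    · rwa [← hadd, pow_succ']
end

section
/- Let q be an odd prime power, F = GF(q²), F₀ the subfield of F of order q (the set of x ∈ F with x^q = x), and ξ a generator of the cyclic group F*. Fix an odd integer j with 1 ≤ j ≤ q, and for each integer t set x_t = −1 − ξ^{t(q+1)−j} ∈ F. Then for every integer t: x_t ≠ 0, x_t ∉ F₀, and x_t·ξ^j ∉ F₀; moreover, for all integers t₁, t₂ with t₁ ≢ t₂ (mod q−1), the ratio x_{t₁}/x_{t₂} does not lie in F₀. -/
/-- In a finite field of order `q ^ 2`, with `q` a prime power, the solutions of `y ^ q = y` form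
a subfield. -/
theorem exists_subfield_mem_iff_pow_eq {q : ℕ} (hq : IsPrimePow q) {F : Type*} [Field F]
    [Fintype F] (hF : Fintype.card F = q ^ 2) :
    ∃ K : Subfield F, ∀ y, y ∈ K ↔ y ^ q = y := by
  obtain ⟨p, k, hp, -, rfl⟩ := hq
  have : Fact p.Prime := ⟨hp.nat_prime⟩
  have : CharP F p := charP_of_card_eq_prime_pow (f := k * 2) (by rw [hF, pow_mul])
  exact ⟨(iterateFrobenius F p k).eqLocusField (RingHom.id F), fun y => Iff.rfl⟩

/-- A generator of the units of a field of order `q ^ 2` has order `(q + 1) * (q - 1)`. -/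
theorem orderOf_generator {q : ℕ} (hq : 1 < q) {F : Type*} [Field F] [Fintype F]
    (hF : Fintype.card F = q ^ 2) {ξ : Fˣ} (hξ : ∀ u : Fˣ, u ∈ Subgroup.zpowers ξ) :
    (orderOf ξ : ℤ) = ((q : ℤ) + 1) * (q - 1) := by
  rw [orderOf_eq_card_of_forall_mem_zpowers hξ, Nat.card_units, Nat.card_eq_fintype_card, hF,
    Nat.cast_sub (Nat.one_le_pow _ _ (by omega))]
  push_cast
  ring

/-- A power `ξ ^ m` of a generator of the units of a field of order `q ^ 2` satisfies
`y ^ q = y` exactly when `q + 1` divides `m`. -/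
theorem zpow_generator_pow_eq_iff {q : ℕ} (hq : 1 < q) {F : Type*} [Field F] [Fintype F]
    (hF : Fintype.card F = q ^ 2) {ξ : Fˣ} (hξ : ∀ u : Fˣ, u ∈ Subgroup.zpowers ξ) (m : ℤ) :
    ((ξ ^ m : Fˣ) : F) ^ q = ((ξ ^ m : Fˣ) : F) ↔ (q : ℤ) + 1 ∣ m := by
  rw [← Units.val_pow_eq_pow_val, Units.val_inj, ← zpow_natCast, ← zpow_mul, ← mul_inv_eq_one,
    ← zpow_neg, ← zpow_add, ← orderOf_dvd_iff_zpow_eq_one, orderOf_generator hq hF hξ,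
    show m * (q : ℤ) + -m = m * (q - 1) by ring]
  exact mul_dvd_mul_iff_right (by omega)

/-- let `F = GF(q²)`, `F₀` its subfield of order `q` (the set of `x` with
`x^q = x`), `ξ` a generator of `F*`, `j` odd with `1 ≤ j ≤ q`, and
`x_t = -1 - ξ^(t(q+1) - j)`. Then every `x_t` is nonzero, lies outside `F₀`, and
`x_t·ξ^j ∉ F₀`; and `x_{t₁}/x_{t₂} ∉ F₀` whenever `t₁ ≢ t₂ (mod q-1)`. -/
theorem values_avoid_base_subfield (q : ℕ) (hq : Odd q) (hq' : IsPrimePow q)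
    (F : Type) [Field F] [Fintype F] (hF : Fintype.card F = q ^ 2)
    (F₀ : Set F) (hF₀ : F₀ = {y : F | y ^ q = y})
    (ξ : Fˣ) (hξ : ∀ u : Fˣ, u ∈ Subgroup.zpowers ξ)
    (j : ℕ) (hj : Odd j) (hj1 : 1 ≤ j) (hjq : j ≤ q)
    (x : ℤ → F) (hx : ∀ t : ℤ, x t = -1 - ((ξ ^ (t * ((q : ℤ) + 1) - (j : ℤ)) : Fˣ) : F)) :
    (∀ t : ℤ, x t ≠ 0 ∧ x t ∉ F₀ ∧ x t * (ξ : F) ^ j ∉ F₀) ∧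
    (∀ t₁ t₂ : ℤ, ¬ t₁ ≡ t₂ [ZMOD ((q : ℤ) - 1)] → x t₁ / x t₂ ∉ F₀) := by
  have hq1 : 1 < q := hq'.one_lt
  obtain ⟨K, hK⟩ := exists_subfield_mem_iff_pow_eq hq' hF
  have hmem (y : F) : y ∈ F₀ ↔ y ∈ K := by rw [hF₀, hK, Set.mem_ofPred_eq]
  have hpow (m : ℤ) : ((ξ ^ m : Fˣ) : F) ∈ K ↔ (q : ℤ) + 1 ∣ m := by
    rw [hK, zpow_generator_pow_eq_iff hq1 hF hξ]
  have he : (ξ : F) ^ j ∉ K := by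
    have h := hpow j
    rw [zpow_natCast, Units.val_pow_eq_pow_val] at h
    rw [h]
    intro hdvd
    have := Int.le_of_dvd (by omega) hdvd
    omega
  let c (t : ℤ) : F := ((ξ ^ (t * ((q : ℤ) + 1)) : Fˣ) : F)
  have hc (t : ℤ) : c t ∈ K := (hpow _).2 (dvd_mul_left _ _)
  have hxe (t : ℤ) : x t * (ξ : F) ^ j = -(ξ : F) ^ j - c t := by
    rw [hx, sub_mul, zpow_sub, zpow_natCast, ← Units.val_pow_eq_pow_val, ← Units.val_mul,
      inv_mul_cancel_right, neg_one_mul]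
  have hxK (t : ℤ) : x t ∉ K := by
    intro h
    have h1 : ((ξ ^ (t * ((q : ℤ) + 1) - (j : ℤ)) : Fˣ) : F) ∈ K := by
      have := K.sub_mem (K.neg_mem K.one_mem) h
      rwa [hx, sub_sub_cancel] at this
    rw [hpow, dvd_sub_right (dvd_mul_left _ _)] at h1
    have := Int.le_of_dvd (by omega) h1
    omega
  have hx0 (t : ℤ) : x t ≠ 0 := fun h => hxK t (h ▸ K.zero_mem)
  refine ⟨fun t => ⟨hx0 t, by rw [hmem]; exact hxK t, ?_⟩, fun t₁ t₂ hne => ?_⟩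
  · rw [hmem, hxe]
    intro h
    apply he
    have := K.neg_mem (K.add_mem h (hc t))
    rwa [sub_add_cancel, neg_neg] at this
  · rw [hmem]
    intro hr
    obtain ⟨r, hrdef⟩ : ∃ r, r = x t₁ / x t₂ := ⟨_, rfl⟩
    rw [← hrdef] at hr
    have hlin : (1 - r) * (ξ : F) ^ j = r * c t₂ - c t₁ := by
      have h1 : x t₁ = r * x t₂ := by rw [hrdef, div_mul_cancel₀ _ (hx0 t₂)]
      linear_combination (-(ξ : F) ^ j) * h1 + hxe t₁ - r * hxe t₂
    by_cases hr1 : r = 1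
    · apply hne
      have hcc : c t₁ = c t₂ := by
        rw [hr1] at hlin
        linear_combination hlin
      have hdvd := (zpow_eq_zpow_iff_modEq.1 (Units.ext hcc)).symm.dvd
      rw [orderOf_generator hq1 hF hξ, ← sub_mul, mul_comm] at hdvd
      exact (Int.modEq_iff_dvd.2 ((mul_dvd_mul_iff_right (by omega)).1 hdvd)).symm
    · apply he
      have h1r : 1 - r ≠ 0 := sub_ne_zero.2 (Ne.symm hr1)
      rw [eq_div_of_mul_eq h1r ((mul_comm _ _).trans hlin)]
      exact K.div_mem (K.sub_mem (K.mul_mem hr (hc _)) (hc _)) (K.sub_mem K.one_mem hr)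
end
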